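/- Let G and H be groups and let φ : G → H be a surjective group homomorphism whose kernel is contained in the center of G (i.e., G is a central extension of H). If H is polycyclic-by-finite, then the commutator subgroup [G, G] is polycyclic-by-finite. -/

import Mathlib

/-- A group is *Noetherian* if every subgroup is finitely generated. -/
def IsNoetherianGroup (G : Type*) [Group G] : Prop := ∀ K : Subgroup G, K.FG

/-- A group is *polycyclic* if and only if it is solvable and Noetherian. -/
def IsPolycyclic (G : Type*) [Group G] : Prop := IsSolvable G ∧ IsNoetherianGroup G

/-- A group is *polycyclic-by-finite* if it has a polycyclic normal subgroup of finite index. -/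
def IsPolycyclicByFinite (G : Type*) [Group G] : Prop :=
  ∃ N : Subgroup G, N.Normal ∧ IsPolycyclic N ∧ N.FiniteIndex

open scoped commutatorElement

theorem Subgroup.FG.map_of_fg {G G' : Type*} [Group G] [Group G'] {K : Subgroup G} (hK : K.FG)
    (f : G →* G') : (K.map f).FG := by
  rw [fg_iff] at hK ⊢
  obtain ⟨S, rfl, hS⟩ := hK
  exact ⟨f '' S, (f.map_closure S).symm, hS.image f⟩

/-- A subgroup with finitely generated image contains a finitely generated subgroup with the
same image. -/
theorem Subgroup.exists_fg_le_map_eq {G G' : Type*} [Group G] [Group G'] (f : G →* G')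
    {K : Subgroup G} (hK : (K.map f).FG) : ∃ A ≤ K, A.FG ∧ A.map f = K.map f := by
  obtain ⟨S, hS, hfin⟩ := (fg_iff _).1 hK
  have hsub : S ⊆ f '' (K : Set G) := by
    rw [← coe_map, ← hS]
    exact subset_closure
  obtain ⟨T, hTK, hTfin, rfl⟩ :=
    (Set.exists_subset_image_finite_and (p := (· = S))).1 ⟨S, hsub, hfin, rfl⟩
  exact ⟨closure T, (closure_le K).2 hTK, (fg_iff _).2 ⟨T, rfl, hTfin⟩, by
    rw [MonoidHom.map_closure, hS]⟩

theorem Subgroup.le_sup_ker_of_map_le {G G' : Type*} [Group G] [Group G'] (f : G →* G')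
    {A K : Subgroup G} (h : K.map f ≤ A.map f) : K ≤ A ⊔ f.ker := by
  rw [← comap_map_eq]
  exact map_le_iff_le_comap.1 h

/-- An extension of a finitely generated group by a finitely generated group is finitely
generated. -/
theorem Subgroup.fg_of_map_of_inf_ker {G G' : Type*} [Group G] [Group G'] (f : G →* G')
    {K : Subgroup G} (hmap : (K.map f).FG) (hker : (K ⊓ f.ker).FG) : K.FG := by
  obtain ⟨A, hAK, hA, hAmap⟩ := exists_fg_le_map_eq f hmap
  have hK : K = A ⊔ K ⊓ f.ker := by
    refine le_antisymm (fun x hx => ?_) (sup_le hAK inf_le_left)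
    obtain ⟨a, ha, k, hk, rfl⟩ :=
      mem_sup_of_normal_right.1 (le_sup_ker_of_map_le f hAmap.ge hx)
    exact mul_mem_sup ha ⟨(mul_mem_cancel_left (hAK ha)).1 hx, hk⟩
  rw [hK]
  exact hA.sup hker

theorem Subgroup.fg_of_isMulCommutative {G : Type*} [Group G] [IsMulCommutative G] [Group.FG G]
    (K : Subgroup G) : K.FG := by
  let _ : CommGroup G := { mul_comm := mul_comm' }
  have : Module.Finite ℤ (Additive G) := Module.Finite.iff_addGroup_fg.2 inferInstance
  have h := IsNoetherian.noetherian (AddSubgroup.toIntSubmodule K.toAddSubgroup)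
  rw [fg_iff_add_fg]
  simpa using Submodule.fg_toAddSubgroup h

theorem Subgroup.FG.of_map_injective {G G' : Type*} [Group G] [Group G'] {K : Subgroup G}
    (f : G →* G') (hf : Function.Injective f) (h : (K.map f).FG) : K.FG := by
  rw [fg_iff_submonoid_fg] at h ⊢
  exact Submonoid.FG.map_injective f hf h

theorem Subgroup.FG.of_le_center {G : Type*} [Group G] {K L : Subgroup G} (hK : K.FG)
    (hc : K ≤ center G) (hLK : L ≤ K) : L.FG := by
  have : IsMulCommutative K :=
    ⟨⟨fun a b => Subtype.ext (mem_center_iff.1 (hc b.2) a)⟩⟩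
  have : Group.FG K := (Group.fg_iff_subgroup_fg K).2 hK
  have h := (fg_of_isMulCommutative (L.subgroupOf K)).map_of_fg K.subtype
  rwa [subgroupOf_map_subtype, inf_eq_left.2 hLK] at h

open Subgroup in
/-- If the pairwise commutators of a symmetric generating set lie in the subgroup generated by
part of that set and by central elements, then so does the commutator subgroup. -/
theorem commutator_le_of_generators {G : Type*} [Group G] {T S C : Set G}
    (hT : closure T = ⊤) (hinv : ∀ t ∈ T, t⁻¹ ∈ T) (hS : S ⊆ T) (hC : C ⊆ center G)
    (hcomm : ∀ t ∈ T, ∀ u ∈ T, ⁅t, u⁆ ∈ closure (S ∪ C)) :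
    commutator G ≤ closure (S ∪ C) := by
  set L := closure (S ∪ C) with hL
  have hconj : ∀ t ∈ T, ∀ x ∈ L, t * x * t⁻¹ ∈ L := by
    intro t ht x hx
    have : L ≤ L.comap (MulAut.conj t).toMonoidHom := by
      conv_lhs => rw [hL]
      rw [closure_le]
      rintro y (hy | hy)
      · have := L.mul_mem (hcomm t ht y (hS hy)) (subset_closure (Or.inl hy))
        simpa [commutatorElement_def] using this
      · have : y ∈ L := subset_closure (Or.inr hy)
        have h := mem_center_iff.1 (hC hy) t
        simpa [h] using this
    simpa using this hx
  have hnormal : L.Normal := by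
    rw [← normalizer_eq_top_iff, eq_top_iff, ← hT, closure_le]
    intro t ht
    rw [SetLike.mem_coe, mem_normalizer_iff]
    refine fun x => ⟨hconj t ht x, fun hx => ?_⟩
    simpa [mul_assoc] using hconj t⁻¹ (hinv t ht) _ hx
  rw [← Subgroup.Normal.quotient_commutative_iff_commutator_le]
  have hgen : closure (QuotientGroup.mk' L '' T) = ⊤ := by
    rw [← MonoidHom.map_closure, hT, ← MonoidHom.range_eq_map,
      MonoidHom.range_eq_top.2 (QuotientGroup.mk'_surjective L)]
  have hcl : IsMulCommutative (closure (QuotientGroup.mk' L '' T)) := by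
    apply isMulCommutative_closure
    rintro _ ⟨t, ht, rfl⟩ _ ⟨u, hu, rfl⟩
    rw [← commutatorElement_eq_one_iff_mul_comm, ← map_commutatorElement, QuotientGroup.mk'_apply,
      QuotientGroup.eq_one_iff]
    exact hcomm t ht u hu
  refine ⟨⟨fun a b => ?_⟩⟩
  have hmem (c : G ⧸ L) : c ∈ closure (QuotientGroup.mk' L '' T) := hgen ▸ mem_top c
  exact setLike_mul_comm (hmem a) (hmem b)

open Subgroup in
theorem exists_fg_commutator_le {G : Type*} [Group G] [Group.FG G] {A K : Subgroup G}
    (hK : K ≤ center G) (hA : A.FG) (hcomm : commutator G ≤ A ⊔ K) :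
    ∃ C ≤ K, C.FG ∧ commutator G ≤ A ⊔ C := by
  obtain ⟨S, rfl, hS⟩ := (fg_iff A).1 hA
  obtain ⟨U, hU, hUfin⟩ := Group.fg_iff.1 ‹Group.FG G›
  set T : Set G := (S ∪ U) ∪ (S ∪ U)⁻¹ with hTdef
  have hTfin : T.Finite := (hS.union hUfin).union (hS.union hUfin).inv
  have hT : closure T = ⊤ := by
    rw [eq_top_iff, ← hU]
    exact closure_mono fun x hx => Or.inl (Or.inr hx)
  have hKn : K.Normal := ⟨fun k hk g => by
    have := mem_center_iff.1 (hK hk) g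
    simpa [this] using hk⟩
  have hex (p : G × G) : ∃ k ∈ K, ∃ a ∈ closure S, a * k = ⁅p.1, p.2⁆ := by
    obtain ⟨a, ha, k, hk, h⟩ := mem_sup_of_normal_right.1
      (hcomm (commutator_mem_commutator (mem_top p.1) (mem_top p.2)))
    exact ⟨k, hk, a, ha, h⟩
  choose k hkK a ha hak using hex
  have hCK : k '' (T ×ˢ T) ⊆ K := by
    rintro _ ⟨p, -, rfl⟩
    exact hkK p
  refine ⟨closure (k '' (T ×ˢ T)), (closure_le K).2 hCK,
    (fg_iff _).2 ⟨_, rfl, (hTfin.prod hTfin).image k⟩, ?_⟩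
  rw [← Subgroup.closure_union]
  refine commutator_le_of_generators hT ?_ (fun x hx => Or.inl (Or.inl hx))
    (hCK.trans hK) fun t ht u hu => ?_
  · rintro t (ht | ht)
    · exact Or.inr (by simpa using ht)
    · exact Or.inl ht
  · rw [← hak (t, u), Subgroup.closure_union]
    exact mul_mem_sup (ha _) (subset_closure ⟨(t, u), ⟨ht, hu⟩, rfl⟩)

theorem Subgroup.fg_of_commutator_le {G : Type*} [Group G] [Group.FG G] {K L : Subgroup G}
    (hL : _root_.commutator G ≤ L) (hKL : (K ⊓ L).FG) : K.FG := by
  have hn : L.Normal := .of_commutator_le G hL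
  have : IsMulCommutative (G ⧸ L) := Normal.quotient_commutative_iff_commutator_le.2 hL
  refine fg_of_map_of_inf_ker (QuotientGroup.mk' L) (fg_of_isMulCommutative _) ?_
  rwa [QuotientGroup.ker_mk']

open Subgroup in
/-- A homomorphism with central kernel from a finitely generated group to a Noetherian group has
finitely generated kernel as soon as its image is solvable (of derived length at most `n`). -/
theorem ker_fg_of_iterate_commutator_eq_bot {H : Type*} [Group H] (hH : IsNoetherianGroup H)
    (n : ℕ) {G : Type*} [Group G] [Group.FG G] (φ : G →* H) (hker : φ.ker ≤ center G)
    (hn : (fun Y : Subgroup H => ⁅Y, Y⁆)^[n] φ.range = ⊥) : φ.ker.FG := by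
  induction n generalizing G with
  | zero =>
    have : φ.ker = ⊤ := MonoidHom.ker_eq_top_iff.2 (MonoidHom.range_eq_bot_iff.1 hn)
    rw [this]
    exact Group.fg_def.1 ‹_›
  | succ n ih =>
    obtain ⟨A, hAD, hA, hAmap⟩ := exists_fg_le_map_eq φ (K := commutator G) (hH _)
    obtain ⟨C, hCK, hC, hle⟩ :=
      exists_fg_commutator_le hker hA (le_sup_ker_of_map_le φ hAmap.ge)
    have hLfg : Group.FG ↥(A ⊔ C) := (Group.fg_iff_subgroup_fg _).2 (hA.sup hC)
    have hmap : (A ⊔ C).map φ = (commutator G).map φ := by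
      rw [Subgroup.map_sup, hAmap, (map_eq_bot_iff C).2 hCK, sup_bot_eq]
    refine fg_of_commutator_le hle ?_
    have h := ih (φ.comp (A ⊔ C).subtype) (fun x hx => ?_) ?_
    · rw [← MonoidHom.comap_ker] at h
      have h' := h.map_of_fg (A ⊔ C).subtype
      rwa [← subgroupOf, subgroupOf_map_subtype] at h'
    · have hx' : (x : G) ∈ center G := hker hx
      exact mem_center_iff.2 fun y => Subtype.ext (mem_center_iff.1 hx' y)
    · rw [MonoidHom.range_comp, range_subtype, hmap, _root_.commutator_def, map_commutator,
        ← MonoidHom.range_eq_map]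
      simpa using hn

theorem iterate_commutator_top (H : Type*) [Group H] (n : ℕ) :
    (fun Y : Subgroup H => ⁅Y, Y⁆)^[n] ⊤ = derivedSeries H n := by
  induction n with
  | zero => rfl
  | succ n ih => rw [Function.iterate_succ_apply', ih, derivedSeries_succ]

theorem ker_fg_of_isPolycyclic {G H : Type*} [Group G] [Group H] [Group.FG G] (φ : G →* H)
    (hsurj : Function.Surjective φ) (hker : φ.ker ≤ Subgroup.center G) (hH : IsPolycyclic H) :
    φ.ker.FG := by
  obtain ⟨n, hn⟩ := hH.1
  refine ker_fg_of_iterate_commutator_eq_bot hH.2 n φ hker ?_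
  rw [MonoidHom.range_eq_top.2 hsurj, iterate_commutator_top, hn]

open Subgroup in
theorem commutator_le_of_sup_center_eq_top {G : Type*} [Group G] {L : Subgroup G}
    (h' : L ⊔ center G = ⊤) : commutator G ≤ L := by
  rw [_root_.commutator_def, commutator_le]
  intro g _ h _
  have hsup (x : G) : ∃ l ∈ L, ∃ z ∈ center G, l * z = x :=
    mem_sup_of_normal_right.1 (h' ▸ mem_top x)
  obtain ⟨l, hl, z, hz, rfl⟩ := hsup g
  obtain ⟨m, hm, w, hw, rfl⟩ := hsup h
  have hz' := mem_center_iff.1 hz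
  have hw' := mem_center_iff.1 hw
  have : ⁅l * z, m * w⁆ = ⁅l, m⁆ := by
    rw [commutatorElement_def, commutatorElement_def]
    calc l * z * (m * w) * (l * z)⁻¹ * (m * w)⁻¹
        = l * (z * m) * w * z⁻¹ * l⁻¹ * w⁻¹ * m⁻¹ := by group
      _ = l * m * (z * w) * z⁻¹ * l⁻¹ * w⁻¹ * m⁻¹ := by rw [← hz' m]; group
      _ = l * m * (w * l⁻¹) * w⁻¹ * m⁻¹ := by rw [hw' z]; group
      _ = l * m * l⁻¹ * m⁻¹ := by rw [← hw' l⁻¹]; group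
  rw [this, commutatorElement_def]
  exact L.mul_mem (L.mul_mem (L.mul_mem hl hm) (L.inv_mem hl)) (L.inv_mem hm)

theorem Subgroup.FG.of_finiteIndex_subgroupOf {G : Type*} [Group G] {K L : Subgroup G} (hL : L.FG)
    [K.FiniteIndex] : (K ⊓ L).FG := by
  have : Group.FG L := (Group.fg_iff_subgroup_fg L).2 hL
  have h : (K.subgroupOf L).FG := (Group.fg_iff_subgroup_fg _).1 inferInstance
  simpa using h.map_of_fg L.subtype

theorem IsPolycyclicByFinite.group_fg {H : Type*} [Group H] (hH : IsPolycyclicByFinite H) :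
    Group.FG H := by
  obtain ⟨N, hN, hpoly, hfin⟩ := hH
  have hNfg : N.FG := (Group.fg_iff_subgroup_fg N).1 (Group.fg_def.2 (hpoly.2 ⊤))
  refine Group.fg_def.2 (Subgroup.fg_of_map_of_inf_ker (QuotientGroup.mk' N) ?_ ?_)
  · exact (Group.fg_iff_subgroup_fg _).1 inferInstance
  · simpa using hNfg

/-- If `φ : G → H` is a surjective group homomorphism whose kernel is contained in the center
of `G` (i.e. `G` is a central extension of `H`) and `H` is polycyclic-by-finite, then the
commutator subgroup `[G, G]` is polycyclic-by-finite. -/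
theorem commutator_polycyclicByFinite_of_central_extension
    {G H : Type*} [Group G] [Group H] (φ : G →* H)
    (hsurj : Function.Surjective φ) (hker : φ.ker ≤ Subgroup.center G)
    (hH : IsPolycyclicByFinite H) :
    IsPolycyclicByFinite ↥(commutator G) := by
  have hHfg := hH.group_fg
  obtain ⟨N, hN, hpoly, hfin⟩ := hH
  have htop : (⊤ : Subgroup G).map φ = ⊤ := Subgroup.map_top_of_surjective φ hsurj
  obtain ⟨G₀, -, hG₀, hmap⟩ := Subgroup.exists_fg_le_map_eq φ (K := ⊤) (htop ▸ Group.fg_def.1 hHfg)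
  rw [htop] at hmap
  have hcomm : commutator G ≤ G₀ := commutator_le_of_sup_center_eq_top <| top_le_iff.1 <|
    (Subgroup.le_sup_ker_of_map_le φ (hmap ▸ le_top)).trans (sup_le_sup_left hker _)
  have hNφ : (N.comap φ).FiniteIndex :=
    ⟨by rw [Subgroup.index_comap_of_surjective N hsurj]; exact hfin.index_ne_zero⟩
  have hX : (N.comap φ ⊓ G₀).FG := hG₀.of_finiteIndex_subgroupOf
  have hXfg : Group.FG ↥(N.comap φ ⊓ G₀) := (Group.fg_iff_subgroup_fg _).2 hX
  have hker_fg : (φ.ker ⊓ (N.comap φ ⊓ G₀)).FG := by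
    let ψ : ↥(N.comap φ ⊓ G₀) →* N :=
      (φ.comp (N.comap φ ⊓ G₀).subtype).codRestrict N fun x => x.2.1
    have hψker : ψ.ker = φ.ker.subgroupOf (N.comap φ ⊓ G₀) := 
      MonoidHom.ker_codRestrict _ _ _
    have h : ψ.ker.FG := by
      refine ker_fg_of_isPolycyclic ψ (fun y => ?_) (fun x hx => ?_) hpoly
      · obtain ⟨g, hg, hgy⟩ : (y : H) ∈ G₀.map φ := hmap ▸ Subgroup.mem_top _
        exact ⟨⟨g, by simp [hgy], hg⟩, Subtype.ext hgy⟩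
      · rw [hψker] at hx
        exact Subgroup.mem_center_iff.2 fun y => Subtype.ext (Subgroup.mem_center_iff.1 (hker hx) y)
    rw [hψker] at h
    simpa only [Subgroup.subgroupOf_map_subtype] using
      h.map_of_fg (N.comap φ ⊓ G₀).subtype
  let ι : ↥((N.comap φ).subgroupOf (commutator G)) →* G :=
    (commutator G).subtype.comp (Subgroup.subtype _)
  have hι : Function.Injective ι := Subtype.val_injective.comp Subtype.val_injective
  let χ : ↥((N.comap φ).subgroupOf (commutator G)) →* N :=
    (φ.comp ι).codRestrict N fun x => x.2
  have hχ (x) (hx : x ∈ χ.ker) : ι x ∈ φ.ker := congrArg Subtype.val hx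
  refine ⟨(N.comap φ).subgroupOf (commutator G), inferInstance, ⟨?_, fun R => ?_⟩, inferInstance⟩
  · have : Group.IsSolvable N := hpoly.1
    have hcomm_ker : Group.IsSolvable χ.ker := Group.isSolvable_of_comm fun a b =>
      Subtype.ext (hι (by simpa using Subgroup.mem_center_iff.1 (hker (hχ b b.2)) (ι a)))
    exact Group.isSolvable_of_ker_le_range χ.ker.subtype χ (by simp)
  · refine Subgroup.fg_of_map_of_inf_ker χ (hpoly.2 _) (Subgroup.FG.of_map_injective ι hι ?_)
    refine hker_fg.of_le_center (inf_le_left.trans hker) ?_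
    rintro _ ⟨x, ⟨-, hx⟩, rfl⟩
    exact ⟨hχ x hx, x.2, hcomm x.1.2⟩
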